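/- Let r_0, r_1, r_2, r_3 ∈ M_2(ℂ) satisfy ρ_1(r_j* r_k) = δ_{jk}. Then for every ν ≥ 1, every 1 ≤ q ≤ 3, every 0 ≤ m < 4^ν and all complex scalars α_0, …, α_{4^{ν+1}−1}, ‖Σ_{j=q·4^ν}^{q·4^ν+m} α_j h^{(ν+1)}_j‖_♯ ≤ 2‖r_q‖² · ‖Σ_{j=0}^{4^{ν+1}−1} α_j h^{(ν+1)}_j‖_♯. -/

import Mathlib

open Finset
open scoped ENNReal ComplexOrder Kronecker Matrix

noncomputable section

/-- Kronecker product of square complex matrices, realized on `Fin (m * n)`. -/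
def kron {m n : ℕ} (x : Matrix (Fin m) (Fin m) ℂ) (y : Matrix (Fin n) (Fin n) ℂ) :
    Matrix (Fin (m * n)) (Fin (m * n)) ℂ :=
  Matrix.reindex finProdFinEquiv finProdFinEquiv (x ⊗ₖ y)

/-- The matrix `A₁ = diag(α, 1 - α)`. -/
def A1 (α : ℝ) : Matrix (Fin 2) (Fin 2) ℂ :=
  Matrix.diagonal ![(α : ℂ), ((1 - α : ℝ) : ℂ)]

/-- The matrix `A₁^t = diag(α^t, (1 - α)^t)` (entrywise real power on the diagonal). -/
def A1t (α t : ℝ) : Matrix (Fin 2) (Fin 2) ℂ :=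
  Matrix.diagonal ![((α ^ t : ℝ) : ℂ), (((1 - α) ^ t : ℝ) : ℂ)]

/-- `Amat α ν = A_ν`, the ν-fold Kronecker power of `diag(α, 1-α)`. -/
def Amat (α : ℝ) : (ν : ℕ) → Matrix (Fin (2 ^ ν)) (Fin (2 ^ ν)) ℂ
  | 0 => 1
  | ν + 1 => kron (Amat α ν) (A1 α)

/-- `Amatt α t ν = A_ν^t`, the ν-fold Kronecker power of `diag(α^t, (1-α)^t)`. -/
def Amatt (α t : ℝ) : (ν : ℕ) → Matrix (Fin (2 ^ ν)) (Fin (2 ^ ν)) ℂ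
  | 0 => 1
  | ν + 1 => kron (Amatt α t ν) (A1t α t)

/-- The state `ρ_ν(x) = Tr (x A_ν)` on `N_ν = M_{2^ν}(ℂ)`. -/
def rho (α : ℝ) (ν : ℕ) (x : Matrix (Fin (2 ^ ν)) (Fin (2 ^ ν)) ℂ) : ℂ :=
  (x * Amat α ν).trace

/-- The state `ρ_1(x) = Tr (x A_1)` on `M_2(ℂ)`. -/
def rho1 (α : ℝ) (x : Matrix (Fin 2) (Fin 2) ℂ) : ℂ :=
  (x * A1 α).trace

/-- The Schatten `p`-norm `‖x‖_{C_p} = (Tr ((x^* x)^{p/2}))^{1/p}`, `1 ≤ p < ∞`,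
computed through the eigenvalues of the positive semidefinite matrix `x^* x`. -/
def schatten {N : ℕ} (p : ℝ) (x : Matrix (Fin N) (Fin N) ℂ) : ℝ :=
  (∑ i, ((Matrix.posSemidef_conjTranspose_mul_self x).isHermitian.eigenvalues i) ^ (p / 2)) ^
    (1 / p)

/-- The operator norm `‖x‖ = ‖x‖_{C_∞}` of a complex matrix (acting on ℓ²). -/
def opNorm {N : ℕ} (x : Matrix (Fin N) (Fin N) ℂ) : ℝ :=
  ‖Matrix.toEuclideanCLM (𝕜 := ℂ) x‖

/-- The left predual norm `‖x‖_♯ = ‖x A_ν‖_{C_1}` on `N_ν`. -/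
def sharpNorm (α : ℝ) {ν : ℕ} (x : Matrix (Fin (2 ^ ν)) (Fin (2 ^ ν)) ℂ) : ℝ :=
  schatten 1 (x * Amat α ν)

/-- The right predual norm `‖x‖_♭ = ‖A_ν x‖_{C_1}` on `N_ν`. -/
def flatNorm (α : ℝ) {ν : ℕ} (x : Matrix (Fin (2 ^ ν)) (Fin (2 ^ ν)) ℂ) : ℝ :=
  schatten 1 (Amat α ν * x)

/-- The left predual norm `‖x‖_♯ = ‖x A_1‖_{C_1}` on `M_2(ℂ)`. -/
def sharp2 (α : ℝ) (x : Matrix (Fin 2) (Fin 2) ℂ) : ℝ :=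
  schatten 1 (x * A1 α)

/-- The right predual norm `‖x‖_♭ = ‖A_1 x‖_{C_1}` on `M_2(ℂ)`. -/
def flat2 (α : ℝ) (x : Matrix (Fin 2) (Fin 2) ℂ) : ℝ :=
  schatten 1 (A1 α * x)

/-- The left norm `‖x‖_{p,♯} = ‖x A_ν^{1/p}‖_{C_p}` on `N_ν`, `1 ≤ p ≤ ∞`
(for `p = ∞` it is the operator norm). -/
def lpSharp (α : ℝ) (p : ℝ≥0∞) {ν : ℕ} (x : Matrix (Fin (2 ^ ν)) (Fin (2 ^ ν)) ℂ) : ℝ :=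
  if p = ∞ then opNorm x else schatten p.toReal (x * Amatt α (1 / p.toReal) ν)

/-- The right norm `‖x‖_{p,♭} = ‖A_ν^{1/p} x‖_{C_p}` on `N_ν`, `1 ≤ p ≤ ∞`. -/
def lpFlat (α : ℝ) (p : ℝ≥0∞) {ν : ℕ} (x : Matrix (Fin (2 ^ ν)) (Fin (2 ^ ν)) ℂ) : ℝ :=
  if p = ∞ then opNorm x else schatten p.toReal (Amatt α (1 / p.toReal) ν * x)

/-- The left norm `‖x‖_{p,♯} = ‖x A_1^{1/p}‖_{C_p}` on `M_2(ℂ)`. -/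
def lp2Sharp (α : ℝ) (p : ℝ≥0∞) (x : Matrix (Fin 2) (Fin 2) ℂ) : ℝ :=
  if p = ∞ then opNorm x else schatten p.toReal (x * A1t α (1 / p.toReal))

/-- `shellNum r c` is `s(r+1, c+1) - 1`, the zero-based shell enumeration index of the
matrix unit `E_{r c}` (zero-based indices `r`, `c`): `s(r,c) = (c-1)² + r` if `r ≤ c`
and `s(r,c) = r² - c + 1` if `r > c` (one-based). -/
def shellNum (r c : ℕ) : ℕ :=
  if r ≤ c then c * c + r else r * r + 2 * r - c

/-- `eUnit N m` is the `m`-th matrix unit `e_m` of `M_N(ℂ)` in the shell enumeration: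
`e_{s(r,c) - 1} = E_{r c}`. -/
def eUnit (N m : ℕ) : Matrix (Fin N) (Fin N) ℂ :=
  Matrix.of fun r c => if shellNum (r : ℕ) (c : ℕ) = m then 1 else 0

/-- The left Haar system `h^{(ν)}_j` in `N_ν` built from `r_0, r_1, r_2, r_3 ∈ M_2(ℂ)`:
`h^{(1)}_j = r_j`, and for `j = 4^ν q + k` (`0 ≤ q ≤ 3`, `0 ≤ k < 4^ν`),
`h^{(ν+1)}_j = h^{(ν)}_k ⊗ r_0` if `q = 0` and `h^{(ν+1)}_j = e^{(ν)}_k ⊗ r_q` if `q ≠ 0`. -/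
def haar (r : ℕ → Matrix (Fin 2) (Fin 2) ℂ) :
    (ν : ℕ) → ℕ → Matrix (Fin (2 ^ ν)) (Fin (2 ^ ν)) ℂ
  | 0, _ => 1
  | 1, j => r (j % 4)
  | ν + 2, j =>
      if j / 4 ^ (ν + 1) = 0 then kron (haar r (ν + 1) j) (r 0)
      else kron (eUnit (2 ^ (ν + 1)) (j % 4 ^ (ν + 1))) (r (j / 4 ^ (ν + 1) % 4))


section HaarHelpers
open scoped Matrix.Norms.L2Operator
open Matrix

theorem hh_mask (m : ℕ) : ∃ R1 C1 R2 C2 : ℕ → Prop,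
    (∀ i, ¬ (R1 i ∧ R2 i)) ∧
    ∀ i j, shellNum i j ≤ m ↔ (R1 i ∧ C1 j) ∨ (R2 i ∧ C2 j) := by
  obtain ⟨n, t, hm, ht⟩ : ∃ n t, m = n * n + t ∧ t ≤ 2 * n := by
    refine ⟨Nat.sqrt m, m - Nat.sqrt m * Nat.sqrt m, ?_, ?_⟩
    · have := Nat.sqrt_le m; omega
    · have := Nat.sqrt_le_add m; omega
  have key : ∀ i j, i < n → j < n → shellNum i j ≤ m := by
    intro i j hi hj
    unfold shellNum
    split_ifs with h
    · nlinarith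
    · have : i * i + 2 * i ≤ m := by nlinarith
      omega
  have key2 : ∀ i j, n < i ∨ n < j → m < shellNum i j := by
    intro i j hij
    unfold shellNum
    split_ifs with h
    · have : n < j := by omega
      nlinarith
    · have : n < i := by omega
      have : m < i * i := by nlinarith
      omega
  by_cases h : t < n
  · refine ⟨fun i => i ≤ t, fun j => j ≤ n, fun i => t < i ∧ i < n, fun j => j < n, ?_, ?_⟩
    · intro i; simp only; omega
    · intro i j
      by_cases h1 : i < n ∧ j < n
      · have := key i j h1.1 h1.2
        simp only; omega
      by_cases h2 : n < i ∨ n < j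
      · have := key2 i j h2
        simp only; omega
      by_cases h3 : j = n
      · subst h3
        unfold shellNum
        rw [if_pos (by omega)]; omega
      · have : i = n := by omega
        subst this
        unfold shellNum
        rw [if_neg (by omega)]; omega
  · refine ⟨fun i => i < n, fun j => j ≤ n, fun i => i = n, fun j => 2 * n - t ≤ j ∧ j ≤ n, ?_, ?_⟩
    · intro i; simp only; omega
    · intro i j
      by_cases h1 : i < n ∧ j < n
      · have := key i j h1.1 h1.2
        simp only; omega
      by_cases h2 : n < i ∨ n < j
      · have := key2 i j h2
        simp only; omega
      by_cases h3 : j = n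
      · subst h3
        unfold shellNum
        rw [if_pos (by omega)]; omega
      · have : i = n := by omega
        subst this
        unfold shellNum
        rw [if_neg (by omega)]; omega

theorem hh_shell_lt {N i j : ℕ} (hi : i < N) (hj : j < N) : shellNum i j < N * N := by
  unfold shellNum
  split_ifs with h
  · nlinarith
  · have : i * i + 2 * i < N * N := by nlinarith
    omega

theorem hh_schatten_one {N : ℕ} (x : Matrix (Fin N) (Fin N) ℂ) :
    schatten 1 x = ∑ i, Real.sqrt
      ((Matrix.posSemidef_conjTranspose_mul_self x).isHermitian.eigenvalues i) := by
  simp [schatten, Real.sqrt_eq_rpow]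

theorem hh_dual_le {N : ℕ} (u x : Matrix (Fin N) (Fin N) ℂ) :
    ‖(u * x).trace‖ ≤ ‖u‖ * schatten 1 x := by
  rw [hh_schatten_one]
  set H := (Matrix.posSemidef_conjTranspose_mul_self x).isHermitian with hH
  have h1 : (u * x).trace = ∑ i, inner ℂ (H.eigenvectorBasis i)
      (toEuclideanCLM (𝕜 := ℂ) (u * x) (H.eigenvectorBasis i)) := by
    have := LinearMap.trace_eq_sum_inner (toEuclideanLin (u * x)) H.eigenvectorBasis
    rw [← coe_toEuclideanCLM_eq_toEuclideanLin] at this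
    rw [← ContinuousLinearMap.coe_coe, ← this, coe_toEuclideanCLM_eq_toEuclideanLin,
      toEuclideanLin, toLpLin_eq_toLin, trace_toLin_eq]
  have h2 : ∀ i, ‖toEuclideanCLM (𝕜 := ℂ) x (H.eigenvectorBasis i)‖
      = Real.sqrt (H.eigenvalues i) := by
    intro i
    have e1 : inner ℂ (toEuclideanCLM (𝕜 := ℂ) x (H.eigenvectorBasis i))
      (toEuclideanCLM (𝕜 := ℂ) x (H.eigenvectorBasis i)) = (H.eigenvalues i : ℂ) := by
      rw [← ContinuousLinearMap.adjoint_inner_right, ← ContinuousLinearMap.star_eq_adjoint,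
        ← map_star, ← mul_apply_eq_comp, ← map_mul]
      have : toEuclideanCLM (𝕜 := ℂ) (star x * x) (H.eigenvectorBasis i)
          = (H.eigenvalues i : ℂ) • H.eigenvectorBasis i := by
        ext k
        have := congrFun (H.mulVec_eigenvectorBasis i) k
        simpa [star_eq_conjTranspose] using this
      rw [this, inner_smul_right, inner_self_eq_norm_sq_to_K]
      simp
    rw [inner_self_eq_norm_sq_to_K] at e1
    have e2 : ‖toEuclideanCLM (𝕜 := ℂ) x (H.eigenvectorBasis i)‖ ^ 2 = H.eigenvalues i := by
      have := congrArg Complex.re e1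
      simpa [← Complex.ofReal_pow] using this
    rw [← e2, Real.sqrt_sq (norm_nonneg _)]
  rw [h1, Finset.mul_sum]
  refine (norm_sum_le _ _).trans (Finset.sum_le_sum fun i _ => ?_)
  refine (norm_inner_le_norm _ _).trans ?_
  rw [map_mul, mul_apply_eq_comp, ← h2, OrthonormalBasis.norm_eq_one, one_mul,
    cstar_norm_def]
  exact ContinuousLinearMap.le_opNorm _ _

theorem hh_dual_attain {N : ℕ} (x : Matrix (Fin N) (Fin N) ℂ) :
    ∃ u : Matrix (Fin N) (Fin N) ℂ, ‖u‖ ≤ 1 ∧ (u * x).trace = (schatten 1 x : ℂ) := by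
  rw [hh_schatten_one]
  set H := (Matrix.posSemidef_conjTranspose_mul_self x).isHermitian with hH
  have hpos : ∀ i, 0 ≤ H.eigenvalues i :=
    (Matrix.posSemidef_conjTranspose_mul_self x).eigenvalues_nonneg
  obtain ⟨U, hU1, hU2, hsp⟩ : ∃ U : Matrix (Fin N) (Fin N) ℂ, Uᴴ * U = 1 ∧ U * Uᴴ = 1 ∧
      xᴴ * x = U * diagonal (fun i => (H.eigenvalues i : ℂ)) * Uᴴ := by
    refine ⟨H.eigenvectorUnitary, ?_, ?_, ?_⟩
    · exact Unitary.coe_star_mul_self H.eigenvectorUnitary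
    · exact Unitary.coe_mul_star_self H.eigenvectorUnitary
    · have := H.spectral_theorem
      rw [Unitary.conjStarAlgAut_apply] at this
      exact this
  generalize H.eigenvalues = ev at *
  set D : Matrix (Fin N) (Fin N) ℂ := diagonal fun i => (((Real.sqrt (ev i))⁻¹ : ℝ) : ℂ)
    with hD
  have hDs : Dᴴ = D := by
    rw [hD, diagonal_conjTranspose]; congr 1; ext i; simp
  have hUn : ‖U‖ ≤ 1 := by
    have h1 := l2_opNorm_conjTranspose_mul_self U
    rw [hU1] at h1
    have h2 : ‖(1 : Matrix (Fin N) (Fin N) ℂ)‖ ≤ 1 := by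
      rw [← diagonal_one, l2_opNorm_diagonal]
      exact (pi_norm_le_iff_of_nonneg zero_le_one).2 (by simp)
    nlinarith [norm_nonneg U]
  have hUn' : ‖Uᴴ‖ ≤ 1 := by rwa [l2_opNorm_conjTranspose]
  refine ⟨U * D * Uᴴ * xᴴ, ?_, ?_⟩
  · have h1 := l2_opNorm_conjTranspose_mul_self (U * D * Uᴴ * xᴴ)ᴴ
    rw [l2_opNorm_conjTranspose] at h1
    have h2 : (U * D * Uᴴ * xᴴ)ᴴᴴ * (U * D * Uᴴ * xᴴ)ᴴ =
        U * diagonal (fun i => if ev i = 0 then (0:ℂ) else 1) * Uᴴ := by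
      simp only [conjTranspose_mul, conjTranspose_conjTranspose, hDs]
      calc _ = U * D * Uᴴ * (xᴴ * x) * (U * D * Uᴴ) := by simp only [Matrix.mul_assoc]
        _ = U * D * (Uᴴ * U) * diagonal (fun i => (ev i : ℂ)) * (Uᴴ * U) * D * Uᴴ := by
          rw [hsp]; simp only [Matrix.mul_assoc]
        _ = _ := by
          rw [hU1, Matrix.mul_one, Matrix.mul_one, Matrix.mul_assoc U, Matrix.mul_assoc U, hD,
            diagonal_mul_diagonal, diagonal_mul_diagonal]
          congr 3
          ext i
          split_ifs with h
          · simp [h]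
          · have : Real.sqrt (ev i) ≠ 0 := by
              rw [Real.sqrt_ne_zero (hpos i)]; exact h
            norm_cast
            nth_rewrite 2 [← Real.mul_self_sqrt (hpos i)]
            field_simp
    rw [h2] at h1
    have h3 : ‖diagonal (fun i => if ev i = 0 then (0:ℂ) else 1)‖ ≤ 1 := by
      rw [l2_opNorm_diagonal]
      refine (pi_norm_le_iff_of_nonneg zero_le_one).2 fun i => ?_
      split_ifs <;> simp
    have h4 := (l2_opNorm_mul (U * diagonal (fun i => if ev i = 0 then (0:ℂ) else 1)) Uᴴ).trans
      (mul_le_one₀ ((l2_opNorm_mul _ _).trans (mul_le_one₀ hUn (norm_nonneg _) h3)) (norm_nonneg _) hUn')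
    nlinarith [norm_nonneg (U * D * Uᴴ * xᴴ)]
  · calc _ = (U * D * (Uᴴ * U) * diagonal (fun i => (ev i : ℂ)) * Uᴴ).trace := by
          rw [Matrix.mul_assoc _ xᴴ x, hsp]; simp only [Matrix.mul_assoc]
      _ = (D * diagonal (fun i => (ev i : ℂ))).trace := by
          rw [hU1, Matrix.mul_one, Matrix.trace_mul_comm, Matrix.mul_assoc U, ← Matrix.mul_assoc,
            hU1, Matrix.one_mul]
      _ = _ := by
          rw [hD, diagonal_mul_diagonal, trace_diagonal]
          push_cast
          refine Finset.sum_congr rfl fun i _ => ?_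
          norm_cast
          by_cases h : ev i = 0
          · simp [h]
          · have : Real.sqrt (ev i) ≠ 0 := by
              rw [Real.sqrt_ne_zero (hpos i)]; exact h
            nth_rewrite 2 [← Real.mul_self_sqrt (hpos i)]
            field_simp

theorem hh_kron_mul {m n : ℕ} (x x' : Matrix (Fin m) (Fin m) ℂ) (y y' : Matrix (Fin n) (Fin n) ℂ) :
    kron x y * kron x' y' = kron (x * x') (y * y') := by
  simp [kron, mul_kronecker_mul, submatrix_mul_equiv]

theorem hh_kron_trace {m n : ℕ} (x : Matrix (Fin m) (Fin m) ℂ) (y : Matrix (Fin n) (Fin n) ℂ) :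
    (kron x y).trace = x.trace * y.trace := by
  rw [← trace_kronecker, kron]
  simp only [trace, Matrix.diag, reindex_apply, submatrix_apply]
  exact Equiv.sum_comp finProdFinEquiv.symm (fun p => (x ⊗ₖ y) p p)

theorem hh_kron_apply {m n : ℕ} (x : Matrix (Fin m) (Fin m) ℂ) (y : Matrix (Fin n) (Fin n) ℂ)
    (p p' : Fin (m * n)) :
    kron x y p p' = x (finProdFinEquiv.symm p).1 (finProdFinEquiv.symm p').1 *
      y (finProdFinEquiv.symm p).2 (finProdFinEquiv.symm p').2 := rfl

def hhHomR (m n : ℕ) : Matrix (Fin n) (Fin n) ℂ →⋆ₙₐ[ℂ] Matrix (Fin (m * n)) (Fin (m * n)) ℂ where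
  toFun y := kron 1 y
  map_smul' c y := by ext; simp [hh_kron_apply]; ring
  map_zero' := by ext; simp [hh_kron_apply]
  map_add' y y' := by ext; simp [hh_kron_apply]; ring
  map_mul' y y' := by rw [hh_kron_mul, one_mul]
  map_star' y := by
    ext p p'; simp only [hh_kron_apply, star_apply, one_apply, star_mul']
    split_ifs <;> simp_all

def hhHomL (m n : ℕ) : Matrix (Fin m) (Fin m) ℂ →⋆ₙₐ[ℂ] Matrix (Fin (m * n)) (Fin (m * n)) ℂ where
  toFun y := kron y 1
  map_smul' c y := by ext; simp [hh_kron_apply]; ring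
  map_zero' := by ext; simp [hh_kron_apply]
  map_add' y y' := by ext; simp [hh_kron_apply]; ring
  map_mul' y y' := by rw [hh_kron_mul, one_mul]
  map_star' y := by
    ext p p'; simp only [hh_kron_apply, star_apply, one_apply, star_mul']
    split_ifs <;> simp_all

theorem hh_normR (m : ℕ) {n : ℕ} (y : Matrix (Fin n) (Fin n) ℂ) :
    ‖(kron 1 y : Matrix (Fin (m * n)) (Fin (m * n)) ℂ)‖ ≤ ‖y‖ :=
  NonUnitalStarAlgHom.norm_apply_le (hhHomR m n) y

theorem hh_normL {m : ℕ} (n : ℕ) (y : Matrix (Fin m) (Fin m) ℂ) :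
    ‖(kron y 1 : Matrix (Fin (m * n)) (Fin (m * n)) ℂ)‖ ≤ ‖y‖ :=
  NonUnitalStarAlgHom.norm_apply_le (hhHomL m n) y

theorem hh_norm_kron {m n : ℕ} (x : Matrix (Fin m) (Fin m) ℂ) (y : Matrix (Fin n) (Fin n) ℂ) :
    ‖kron x y‖ ≤ ‖x‖ * ‖y‖ := by
  have : kron x y = kron x 1 * kron 1 y := by rw [hh_kron_mul]; simp
  rw [this]
  exact (l2_opNorm_mul _ _).trans
    (mul_le_mul (hh_normL n x) (hh_normR m y) (norm_nonneg _) (norm_nonneg _))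

/-- The isometry `ξ ↦ ξ ⊗ e_k`. -/
def hhV (N : ℕ) (k : Fin 2) : Matrix (Fin (N * 2)) (Fin N) ℂ :=
  Matrix.of fun p i => if finProdFinEquiv.symm p = (i, k) then 1 else 0

theorem hh_one_norm (N : ℕ) : ‖(1 : Matrix (Fin N) (Fin N) ℂ)‖ ≤ 1 := by
  rw [← diagonal_one, l2_opNorm_diagonal]
  exact (pi_norm_le_iff_of_nonneg zero_le_one).2 (by simp)

theorem hhV_norm (N : ℕ) (k : Fin 2) : ‖hhV N k‖ ≤ 1 := by
  have h1 := l2_opNorm_conjTranspose_mul_self (hhV N k)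
  have h2 : (hhV N k)ᴴ * hhV N k = 1 := by
    ext i j
    rw [mul_apply, ← Equiv.sum_comp finProdFinEquiv]
    simp only [hhV, conjTranspose_apply, of_apply, Equiv.symm_apply_apply]
    rw [Finset.sum_eq_single (j, k)]
    · by_cases h : i = j
      · subst h; simp
      · have : ¬ ((j, k) = (i, k)) := fun hh => h (congrArg Prod.fst hh).symm
        simp [h, this]
    · intro b _ hb
      simp [hb]
    · simp
  rw [h2] at h1
  have := hh_one_norm N
  nlinarith [norm_nonneg (hhV N k)]

theorem hh_kron_A1 (α : ℝ) {N : ℕ} (Z : Matrix (Fin N) (Fin N) ℂ) :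
    kron Z (A1 α) = (α : ℂ) • (hhV N 0 * Z * (hhV N 0)ᴴ)
      + ((1 - α : ℝ) : ℂ) • (hhV N 1 * Z * (hhV N 1)ᴴ) := by
  have h : ∀ k p p', (hhV N k * Z * (hhV N k)ᴴ) p p' =
      if (finProdFinEquiv.symm p).2 = k ∧ (finProdFinEquiv.symm p').2 = k then
        Z (finProdFinEquiv.symm p).1 (finProdFinEquiv.symm p').1 else 0 := by
    intro k p p'
    generalize hs : finProdFinEquiv.symm p = s
    generalize hs' : finProdFinEquiv.symm p' = s'
    obtain ⟨i, a⟩ := s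
    obtain ⟨j, b⟩ := s'
    simp only [mul_apply, hhV, hs, hs', conjTranspose_apply, of_apply, Prod.mk.injEq]
    by_cases ha : a = k <;> by_cases hb : b = k <;> simp [ha, hb]
  ext p p'
  rw [hh_kron_apply, Matrix.add_apply, Matrix.smul_apply, Matrix.smul_apply, h, h, A1]
  generalize finProdFinEquiv.symm p = s
  generalize finProdFinEquiv.symm p' = s'
  obtain ⟨i, a⟩ := s
  obtain ⟨j, b⟩ := s'
  fin_cases a <;> fin_cases b <;> simp [mul_comm]

theorem hh_slice (α : ℝ) (h0 : 0 ≤ α) (h1 : α ≤ 1) {N : ℕ}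
    (u : Matrix (Fin (N * 2)) (Fin (N * 2)) ℂ) (hu : ‖u‖ ≤ 1) (r : Matrix (Fin 2) (Fin 2) ℂ) :
    ∃ Φ : Matrix (Fin N) (Fin N) ℂ, ‖Φ‖ ≤ ‖r‖ ∧
      ∀ Z, (u * kron Z (r * A1 α)).trace = (Φ * Z).trace := by
  set G : Fin 2 → Matrix (Fin N) (Fin N) ℂ := fun k => (hhV N k)ᴴ * (u * kron 1 r) * hhV N k with hG
  have hGn : ∀ k, ‖G k‖ ≤ ‖r‖ := by
    intro k
    have hV := hhV_norm N k
    have hV' : ‖(hhV N k)ᴴ‖ ≤ 1 := by rwa [l2_opNorm_conjTranspose]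
    have a1 : ‖u * kron 1 r‖ ≤ 1 * ‖r‖ := (l2_opNorm_mul _ _).trans
      (mul_le_mul hu (hh_normR N r) (norm_nonneg _) zero_le_one)
    have a2 : ‖(hhV N k)ᴴ * (u * kron 1 r)‖ ≤ 1 * (1 * ‖r‖) := (l2_opNorm_mul _ _).trans
      (mul_le_mul hV' a1 (norm_nonneg _) zero_le_one)
    have a3 : ‖G k‖ ≤ (1 * (1 * ‖r‖)) * 1 := (l2_opNorm_mul _ _).trans
      (mul_le_mul a2 hV (norm_nonneg _) (by positivity))
    linarith
  refine ⟨(α : ℂ) • G 0 + ((1 - α : ℝ) : ℂ) • G 1, ?_, ?_⟩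
  · refine (norm_add_le _ _).trans ?_
    rw [norm_smul, norm_smul, Complex.norm_real, Complex.norm_real, Real.norm_of_nonneg h0,
      Real.norm_of_nonneg (by linarith)]
    nlinarith [hGn 0, hGn 1]
  · intro Z
    have e : kron Z (r * A1 α) = kron 1 r * kron Z (A1 α) := by rw [hh_kron_mul, one_mul]
    have t : ∀ k, (u * (kron 1 r * (hhV N k * Z * (hhV N k)ᴴ))).trace = (G k * Z).trace := by
      intro k
      calc _ = ((u * kron 1 r * hhV N k * Z) * (hhV N k)ᴴ).trace := by
            simp only [Matrix.mul_assoc]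
        _ = ((hhV N k)ᴴ * (u * kron 1 r * hhV N k * Z)).trace := Matrix.trace_mul_comm _ _
        _ = _ := by simp only [hG, Matrix.mul_assoc]
    rw [e, hh_kron_A1]
    simp only [Matrix.mul_add, Matrix.add_mul, Matrix.mul_smul, Matrix.smul_mul, trace_add,
      trace_smul, t]

theorem hh_Amat_diag (α : ℝ) (ν : ℕ) : ∃ d, Amat α ν = diagonal d := by
  induction ν with
  | zero => exact ⟨1, by rw [Amat]; exact diagonal_one.symm⟩
  | succ n ih =>
    obtain ⟨d, hd⟩ := ih
    rw [Amat, hd, A1]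
    simp only [kron, diagonal_kronecker_diagonal, reindex_apply, submatrix_diagonal_equiv]
    exact ⟨_, rfl⟩
    
theorem hh_haar (r : ℕ → Matrix (Fin 2) (Fin 2) ℂ) (ν : ℕ) (hν : 1 ≤ ν) (q k : ℕ) (hq1 : 1 ≤ q)
    (hq3 : q ≤ 3) (hk : k < 4 ^ ν) :
    haar r (ν + 1) (q * 4 ^ ν + k) = kron (eUnit (2 ^ ν) k) (r q) := by
  obtain ⟨n, rfl⟩ : ∃ n, ν = n + 1 := ⟨ν - 1, by omega⟩
  have h1 : (q * 4 ^ (n + 1) + k) / 4 ^ (n + 1) = q := by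
    rw [Nat.mul_comm, Nat.mul_add_div (by positivity), Nat.div_eq_of_lt hk, add_zero]
  have h2 : (q * 4 ^ (n + 1) + k) % 4 ^ (n + 1) = k := by
    rw [Nat.mul_comm, Nat.mul_add_mod, Nat.mod_eq_of_lt hk]
  have h3 : q % 4 = q := Nat.mod_eq_of_lt (by omega)
  have h4 : ¬ q = 0 := by omega
  have := haar.eq_3 r (q * 4 ^ (n + 1) + k) n
  rw [h1, h2, h3] at this
  exact this.trans (if_neg h4)

theorem hh_haar0 (r : ℕ → Matrix (Fin 2) (Fin 2) ℂ) (ν : ℕ) (hν : 1 ≤ ν) (k : ℕ)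
    (hk : k < 4 ^ ν) :
    haar r (ν + 1) k = kron (haar r ν k) (r 0) := by
  obtain ⟨n, rfl⟩ : ∃ n, ν = n + 1 := ⟨ν - 1, by omega⟩
  exact (haar.eq_3 r k n).trans (if_pos (Nat.div_eq_of_lt hk))

theorem hh_kron_sum {ι : Type*} (s : Finset ι) {m n : ℕ} (c : ι → ℂ)
    (x : ι → Matrix (Fin m) (Fin m) ℂ) (y : Matrix (Fin n) (Fin n) ℂ) :
    ∑ j ∈ s, c j • kron (x j) y = kron (∑ j ∈ s, c j • x j) y := by
  ext p p'
  simp [hh_kron_apply, Matrix.sum_apply, Finset.sum_mul, mul_assoc]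

theorem hh_eUnit_sum (N M : ℕ) (c : ℕ → ℂ) (i j : Fin N) :
    (∑ k ∈ Finset.range M, c k • eUnit N k) i j =
      if shellNum i j < M then c (shellNum i j) else 0 := by
  rw [Matrix.sum_apply]
  simp [eUnit]

theorem hh_trunc {N m : ℕ} (c : ℕ → ℂ) :
    ∃ e1 f1 e2 f2 : Fin N → ℂ, ‖diagonal e1‖ ≤ 1 ∧ ‖diagonal f1‖ ≤ 1 ∧ ‖diagonal e2‖ ≤ 1 ∧
      ‖diagonal f2‖ ≤ 1 ∧
      ∑ k ∈ Finset.range (m + 1), c k • eUnit N k =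
        diagonal e1 * (∑ k ∈ Finset.range (N * N), c k • eUnit N k) * diagonal f1 +
        diagonal e2 * (∑ k ∈ Finset.range (N * N), c k • eUnit N k) * diagonal f2 := by
  classical
  obtain ⟨R1, C1, R2, C2, hd, h⟩ := hh_mask m
  have hn : ∀ P : ℕ → Prop, ‖diagonal (fun i : Fin N => if P i then (1:ℂ) else 0)‖ ≤ 1 := by
    intro P
    rw [l2_opNorm_diagonal]
    refine (pi_norm_le_iff_of_nonneg zero_le_one).2 fun i => ?_
    split_ifs <;> simp
  refine ⟨_, _, _, _, hn R1, hn C1, hn R2, hn C2, ?_⟩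
  ext i j
  rw [Matrix.add_apply, mul_diagonal, mul_diagonal, diagonal_mul, diagonal_mul, hh_eUnit_sum,
    hh_eUnit_sum, if_pos (hh_shell_lt i.2 j.2)]
  have := h i j
  have := hd i
  simp only [Nat.lt_succ_iff]
  by_cases a1 : R1 i <;> by_cases a2 : C1 j <;> by_cases a3 : R2 i <;> by_cases a4 : C2 j <;>
    simp_all

theorem hh_sum_range_mul {M : Type*} [AddCommMonoid M] (f : ℕ → M) (n K : ℕ) :
    ∑ j ∈ Finset.range (n * K), f j =
      ∑ p ∈ Finset.range n, ∑ k ∈ Finset.range K, f (p * K + k) := by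
  induction n with
  | zero => simp
  | succ n ih => rw [Nat.succ_mul, Finset.sum_range_add, ih, Finset.sum_range_succ]

theorem hh_core (α : ℝ) (hα0 : 0 ≤ α) (hα : α ≤ 1)
    (r : ℕ → Matrix (Fin 2) (Fin 2) ℂ)
    (hr : ∀ j < 4, ∀ k < 4, rho1 α ((r j)ᴴ * r k) = if j = k then 1 else 0)
    {N : ℕ} (d : Fin N → ℂ) (x : ℕ → Matrix (Fin N) (Fin N) ℂ) (q : ℕ) (hq : q < 4)
    (c : ℕ → ℂ) (hx : x q = ∑ k ∈ Finset.range (N * N), c k • eUnit N k) (m : ℕ) :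
    schatten 1 (kron (∑ k ∈ Finset.range (m + 1), c k • eUnit N k) (r q) *
        kron (diagonal d) (A1 α)) ≤
      2 * opNorm (r q) ^ 2 *
        schatten 1 ((∑ p ∈ Finset.range 4, kron (x p) (r p)) * kron (diagonal d) (A1 α)) := by
  obtain ⟨e1, f1, e2, f2, he1, hf1, he2, hf2, ht⟩ := hh_trunc (N := N) (m := m) c
  rw [← hx] at ht
  rw [ht]
  obtain ⟨u, hu, hut⟩ := hh_dual_attain (kron (diagonal e1 * x q * diagonal f1 +
    diagonal e2 * x q * diagonal f2) (r q) * kron (diagonal d) (A1 α))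
  obtain ⟨Φ, hΦ, hΦt⟩ := hh_slice α hα0 hα u hu (r q)
  rw [hh_kron_mul, hΦt, ← hh_kron_mul] at hut
  set Ψ := diagonal f1 * Φ * diagonal e1 + diagonal f2 * Φ * diagonal e2 with hΨ
  have hΨn : ‖Ψ‖ ≤ 2 * ‖r q‖ := by
    have a : ∀ e f : Fin N → ℂ, ‖diagonal e‖ ≤ 1 → ‖diagonal f‖ ≤ 1 →
        ‖diagonal f * Φ * diagonal e‖ ≤ ‖r q‖ := by
      intro e f he hf
      have b1 : ‖diagonal f * Φ‖ ≤ 1 * ‖r q‖ := (l2_opNorm_mul _ _).trans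
        (mul_le_mul hf hΦ (norm_nonneg _) zero_le_one)
      have b2 : ‖diagonal f * Φ * diagonal e‖ ≤ 1 * ‖r q‖ * 1 := (l2_opNorm_mul _ _).trans
        (mul_le_mul b1 he (norm_nonneg _) (by positivity))
      linarith
    have := norm_add_le (diagonal f1 * Φ * diagonal e1) (diagonal f2 * Φ * diagonal e2)
    have := a e1 f1 he1 hf1
    have := a e2 f2 he2 hf2
    linarith
  have hΨt : (Φ * ((diagonal e1 * x q * diagonal f1 + diagonal e2 * x q * diagonal f2) *
      diagonal d)).trace = (Ψ * x q * diagonal d).trace := by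
    have a : ∀ e f : Fin N → ℂ, (Φ * (diagonal e * x q * diagonal f * diagonal d)).trace =
        (diagonal f * Φ * diagonal e * x q * diagonal d).trace := by
      intro e f
      have hc : diagonal f * diagonal d = diagonal d * diagonal f := by
        rw [diagonal_mul_diagonal, diagonal_mul_diagonal]; simp only [mul_comm]
      calc _ = ((Φ * diagonal e * x q * diagonal d) * diagonal f).trace := by
            simp only [Matrix.mul_assoc, hc]
        _ = (diagonal f * (Φ * diagonal e * x q * diagonal d)).trace := Matrix.trace_mul_comm _ _
        _ = _ := by simp only [Matrix.mul_assoc]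
    rw [Matrix.add_mul, Matrix.mul_add, trace_add, a, a, hΨ, Matrix.add_mul, Matrix.add_mul,
      trace_add]
  have hfin : (kron Ψ (r q)ᴴ * ((∑ p ∈ Finset.range 4, kron (x p) (r p)) *
      kron (diagonal d) (A1 α))).trace = (Ψ * x q * diagonal d).trace := by
    have a : ∀ p ∈ Finset.range 4, (kron Ψ (r q)ᴴ * (kron (x p) (r p) *
        kron (diagonal d) (A1 α))).trace = if q = p then (Ψ * x p * diagonal d).trace else 0 := by
      intro p hp
      have h := hr q hq p (Finset.mem_range.1 hp)
      rw [rho1] at h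
      rw [hh_kron_mul, hh_kron_mul, hh_kron_trace, ← Matrix.mul_assoc, ← Matrix.mul_assoc, h]
      split_ifs <;> simp
    rw [Finset.sum_mul, Finset.mul_sum, trace_sum, Finset.sum_congr rfl a, Finset.sum_ite_eq,
      if_pos (Finset.mem_range.2 hq)]
  have hle := hh_dual_le (kron Ψ (r q)ᴴ) ((∑ p ∈ Finset.range 4, kron (x p) (r p)) *
      kron (diagonal d) (A1 α))
  rw [hfin, ← hΨt, hut, Complex.norm_real] at hle
  refine (Real.le_norm_self _).trans (hle.trans ?_)
  have hn : ‖kron Ψ (r q)ᴴ‖ ≤ 2 * opNorm (r q) ^ 2 := by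
    have h1 := hh_norm_kron Ψ (r q)ᴴ
    rw [l2_opNorm_conjTranspose] at h1
    have h2 : opNorm (r q) = ‖r q‖ := rfl
    rw [h2]
    nlinarith [norm_nonneg (r q)]
  refine mul_le_mul_of_nonneg_right hn ?_
  rw [hh_schatten_one]
  exact Finset.sum_nonneg fun i _ => Real.sqrt_nonneg _

end HaarHelpers

/-- the block estimate
`‖Σ_{j=q4^ν}^{q4^ν+m} α_j h^{(ν+1)}_j‖_♯ ≤ 2‖r_q‖² ‖Σ_{j<4^{ν+1}} α_j h^{(ν+1)}_j‖_♯`. -/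
theorem haar_block_estimate_sharp
    (α : ℝ) (hα0 : 0 < α) (hα : α ≤ 1 / 2)
    (r : ℕ → Matrix (Fin 2) (Fin 2) ℂ)
    (hr : ∀ j < 4, ∀ k < 4, rho1 α ((r j)ᴴ * r k) = if j = k then 1 else 0)
    (ν : ℕ) (hν : 1 ≤ ν) (q : ℕ) (hq1 : 1 ≤ q) (hq3 : q ≤ 3)
    (m : ℕ) (hm : m < 4 ^ ν) (a : ℕ → ℂ) :
    sharpNorm α (∑ j ∈ Finset.Icc (q * 4 ^ ν) (q * 4 ^ ν + m), a j • haar r (ν + 1) j) ≤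
      2 * opNorm (r q) ^ 2 *
        sharpNorm α (∑ j ∈ Finset.range (4 ^ (ν + 1)), a j • haar r (ν + 1) j) := by
  classical
  have h4 : 4 ^ ν = 2 ^ ν * 2 ^ ν := by rw [← Nat.mul_pow]
  obtain ⟨d, hd⟩ := hh_Amat_diag α ν
  have hA : Amat α (ν + 1) = kron (Matrix.diagonal d) (A1 α) := by rw [← hd]; rfl
  set c : ℕ → ℂ := fun k => a (q * 4 ^ ν + k) with hc
  set x : ℕ → Matrix (Fin (2 ^ ν)) (Fin (2 ^ ν)) ℂ := fun p =>
    if p = 0 then ∑ k ∈ Finset.range (4 ^ ν), a k • haar r ν k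
    else ∑ k ∈ Finset.range (4 ^ ν), a (p * 4 ^ ν + k) • eUnit (2 ^ ν) k with hx
  have hblock : ∀ p < 4, ∑ k ∈ Finset.range (4 ^ ν),
      a (p * 4 ^ ν + k) • haar r (ν + 1) (p * 4 ^ ν + k) = kron (x p) (r p) := by
    intro p hp
    by_cases h0 : p = 0
    · subst h0
      simp only [hx, if_true, zero_mul, zero_add]
      refine Eq.trans ?_ (hh_kron_sum _ _ _ _)
      refine Finset.sum_congr rfl fun k hk => ?_
      exact congrArg _ (hh_haar0 r ν hν k (Finset.mem_range.1 hk))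
    · simp only [hx, if_neg h0]
      refine Eq.trans ?_ (hh_kron_sum _ _ _ _)
      refine Finset.sum_congr rfl fun k hk => ?_
      exact congrArg _ (hh_haar r ν hν p k (by omega) (by omega) (Finset.mem_range.1 hk))
  have hR : ∑ j ∈ Finset.range (4 ^ (ν + 1)), a j • haar r (ν + 1) j =
      ∑ p ∈ Finset.range 4, kron (x p) (r p) := by
    have e : 4 ^ (ν + 1) = 4 * 4 ^ ν := by rw [pow_succ, Nat.mul_comm]
    refine (congrArg (fun M => ∑ j ∈ Finset.range M, a j • haar r (ν + 1) j) e).trans ?_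
    refine (hh_sum_range_mul _ _ _).trans ?_
    exact Finset.sum_congr rfl fun p hp => hblock p (Finset.mem_range.1 hp)
  have hL : ∑ j ∈ Finset.Icc (q * 4 ^ ν) (q * 4 ^ ν + m), a j • haar r (ν + 1) j =
      kron (∑ k ∈ Finset.range (m + 1), c k • eUnit (2 ^ ν) k) (r q) := by
    rw [← Finset.Ico_add_one_right_eq_Icc, Finset.sum_Ico_eq_sum_range,
      show q * 4 ^ ν + m + 1 - q * 4 ^ ν = m + 1 by omega]
    refine Eq.trans ?_ (hh_kron_sum _ _ _ _)
    refine Finset.sum_congr rfl fun k hk => ?_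
    have := Finset.mem_range.1 hk
    exact congrArg _ (hh_haar r ν hν q k hq1 hq3 (by omega))
  have hcore := hh_core α hα0.le (by linarith) r hr d x q (by omega) c
    (by simp only [hx, hc]; rw [if_neg (by omega), h4]) m
  unfold sharpNorm
  rw [hL, hR, hA]
  exact hcore

end
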